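/- Let n ≥ 2 be an even integer. The polynomial f = [x₁,x₂][x₃,x₄]⋯[x_{n+3},x_{n+4}] (a product of (n+4)/2 commutators in n+4 distinct variables) is a polynomial identity of both relatively free algebras F_n(A) and F_{n+1}(A). -/

import Mathlib

noncomputable section

/-- `f ∈ K⟨X⟩` (with set of variables `X`) is a polynomial identity of the `K`-algebra `R`:
every substitution of elements of `R` for the variables (i.e. every `K`-algebra homomorphism
from the free algebra to `R`) kills `f`. -/
def IsPI (K : Type) [Field K] {X : Type} (R : Type) [Ring R] [Algebra K R]
    (f : FreeAlgebra K X) : Prop :=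
  ∀ φ : FreeAlgebra K X →ₐ[K] R, φ f = 0

/-- `T(R)`: the set of polynomial identities of `R` inside `K⟨x₁, x₂, …⟩`
(the free unital associative algebra on countably many variables, indexed by `ℕ`). -/
def TId (K : Type) [Field K] (R : Type) [Ring R] [Algebra K R] : Set (FreeAlgebra K ℕ) :=
  {f | IsPI K R f}

/-- A two-sided ideal of `K⟨X⟩` is a T-ideal when it is invariant under all algebra
endomorphisms of `K⟨X⟩`. -/
def IsTIdeal (K : Type) [Field K] (I : TwoSidedIdeal (FreeAlgebra K ℕ)) : Prop :=
  ∀ φ : FreeAlgebra K ℕ →ₐ[K] FreeAlgebra K ℕ, ∀ f ∈ I, φ f ∈ I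

/-- `⟨F⟩^T`: the smallest T-ideal of `K⟨X⟩` containing the set `F`. -/
def TIdealGen (K : Type) [Field K] (F : Set (FreeAlgebra K ℕ)) : Set (FreeAlgebra K ℕ) :=
  {g | ∀ I : TwoSidedIdeal (FreeAlgebra K ℕ), IsTIdeal K I → F ⊆ (I : Set (FreeAlgebra K ℕ)) → g ∈ I}

/-- The commutator `[a, b] = a * b - b * a`. -/
def br {R : Type} [Ring R] (a b : R) : R := a * b - b * a

/-- The left-normed commutator `[a, b, b, …, b]` with `k` occurrences of `b`. -/
def commPow {R : Type} [Ring R] (a b : R) (k : ℕ) : R := (fun y => br y b)^[k] a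

/-- The variable `xᵢ` of `K⟨x₁, x₂, …⟩` (1-based indexing). -/
def xv (K : Type) [Field K] (i : ℕ) : FreeAlgebra K ℕ := FreeAlgebra.ι K i

/-- The product of commutators `[x₁,x₂][x₃,x₄]⋯[x_{2k-1},x_{2k}]`. -/
def chainProd (K : Type) [Field K] (k : ℕ) : FreeAlgebra K ℕ :=
  ((List.range k).map fun i => br (xv K (2 * i + 1)) (xv K (2 * i + 2))).prod

/-- The Grassmann (exterior) algebra of an infinite dimensional `K`-vector space
with basis `e₁, e₂, …`. -/
abbrev Einf (K : Type) [Field K] : Type := ExteriorAlgebra K (ℕ →₀ K)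

/-- The Grassmann (exterior) algebra `E⁽ⁿ⁾` of an `n`-dimensional `K`-vector space. -/
abbrev Efin (K : Type) [Field K] (n : ℕ) : Type := ExteriorAlgebra K (Fin n → K)

/-- The even part `E₀` of the Grassmann algebra of `V`. -/
def evenPart (K V : Type) [Field K] [AddCommGroup V] [Module K V] :
    Submodule K (ExteriorAlgebra K V) :=
  CliffordAlgebra.evenOdd (0 : QuadraticForm K V) 0

/-- The odd part `E₁` of the Grassmann algebra of `V`. -/
def oddPart (K V : Type) [Field K] [AddCommGroup V] [Module K V] :
    Submodule K (ExteriorAlgebra K V) :=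
  CliffordAlgebra.evenOdd (0 : QuadraticForm K V) 1

section matrixAlgebras

variable (K V : Type) [Field K] [AddCommGroup V] [Module K V]

private theorem evenPart_mul_mem {a b : ExteriorAlgebra K V}
    (ha : a ∈ evenPart K V) (hb : b ∈ evenPart K V) : a * b ∈ evenPart K V := by
  have := CliffordAlgebra.evenOdd_mul_le (Q := (0 : QuadraticForm K V)) 0 0
    (Submodule.mul_mem_mul ha hb)
  simpa [evenPart] using this

private theorem evenPart_one_mem : (1 : ExteriorAlgebra K V) ∈ evenPart K V :=
  SetLike.one_mem_graded _

private theorem evenPart_algebraMap_mem (c : K) :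
    algebraMap K (ExteriorAlgebra K V) c ∈ evenPart K V :=
  SetLike.algebraMap_mem_graded _ c

/-- The algebra `A` (over the Grassmann algebra of `V`): the subalgebra of `2 × 2`
matrices over `E = Λ(V)` whose `(1,1)` entry lies in `E₀`, whose `(2,1)` entry is `0`,
and whose `(1,2)` and `(2,2)` entries are arbitrary. -/
def algA : Subalgebra K (Matrix (Fin 2) (Fin 2) (ExteriorAlgebra K V)) where
  carrier := {M | M 0 0 ∈ evenPart K V ∧ M 1 0 = 0}
  mul_mem' := by
    rintro a b ⟨ha0, ha1⟩ ⟨hb0, hb1⟩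
    refine ⟨?_, ?_⟩
    · have h : (a * b) 0 0 = a 0 0 * b 0 0 + a 0 1 * b 1 0 := by
        simp [Matrix.mul_apply, Fin.sum_univ_two]
      rw [h, hb1, mul_zero, add_zero]
      exact evenPart_mul_mem K V ha0 hb0
    · have h : (a * b) 1 0 = a 1 0 * b 0 0 + a 1 1 * b 1 0 := by
        simp [Matrix.mul_apply, Fin.sum_univ_two]
      rw [h, ha1, hb1, zero_mul, mul_zero, add_zero]
  one_mem' := by
    refine ⟨?_, ?_⟩
    · rw [Matrix.one_apply_eq]; exact evenPart_one_mem K V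
    · exact Matrix.one_apply_ne (by decide)
  add_mem' := by
    rintro a b ⟨ha0, ha1⟩ ⟨hb0, hb1⟩
    exact ⟨Submodule.add_mem _ ha0 hb0, by simp [ha1, hb1]⟩
  zero_mem' := ⟨Submodule.zero_mem _, rfl⟩
  algebraMap_mem' := fun c => by
    refine ⟨?_, ?_⟩
    · rw [Matrix.algebraMap_matrix_apply, if_pos rfl]
      exact evenPart_algebraMap_mem K V c
    · rw [Matrix.algebraMap_matrix_apply, if_neg (by decide)]

end matrixAlgebras

section matrixAlgebras2

variable (K V : Type) [Field K] [AddCommGroup V] [Module K V]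

private theorem oddPart_mul_mem_even {a b : ExteriorAlgebra K V}
    (ha : a ∈ oddPart K V) (hb : b ∈ oddPart K V) : a * b ∈ evenPart K V := by
  have := CliffordAlgebra.evenOdd_mul_le (Q := (0 : QuadraticForm K V)) 1 1
    (Submodule.mul_mem_mul ha hb)
  have h2 : ((1 : ZMod 2) + 1) = 0 := by decide
  rw [h2] at this
  exact this

private theorem even_mul_odd_mem {a b : ExteriorAlgebra K V}
    (ha : a ∈ evenPart K V) (hb : b ∈ oddPart K V) : a * b ∈ oddPart K V := by
  have := CliffordAlgebra.evenOdd_mul_le (Q := (0 : QuadraticForm K V)) 0 1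
    (Submodule.mul_mem_mul ha hb)
  rw [zero_add] at this
  exact this

private theorem odd_mul_even_mem {a b : ExteriorAlgebra K V}
    (ha : a ∈ oddPart K V) (hb : b ∈ evenPart K V) : a * b ∈ oddPart K V := by
  have := CliffordAlgebra.evenOdd_mul_le (Q := (0 : QuadraticForm K V)) 1 0
    (Submodule.mul_mem_mul ha hb)
  rw [add_zero] at this
  exact this

/-- The algebra `A′` (over the Grassmann algebra of `V`): the subalgebra of `2 × 2`
matrices over `E = Λ(V)` whose `(2,2)` entry lies in `E₀`, whose `(2,1)` entry is `0`,
and whose `(1,1)` and `(1,2)` entries are arbitrary. -/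
def algA' : Subalgebra K (Matrix (Fin 2) (Fin 2) (ExteriorAlgebra K V)) where
  carrier := {M | M 1 1 ∈ evenPart K V ∧ M 1 0 = 0}
  mul_mem' := by
    rintro a b ⟨ha0, ha1⟩ ⟨hb0, hb1⟩
    refine ⟨?_, ?_⟩
    · have h : (a * b) 1 1 = a 1 0 * b 0 1 + a 1 1 * b 1 1 := by
        simp [Matrix.mul_apply, Fin.sum_univ_two]
      rw [h, ha1, zero_mul, zero_add]
      exact evenPart_mul_mem K V ha0 hb0
    · have h : (a * b) 1 0 = a 1 0 * b 0 0 + a 1 1 * b 1 0 := by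
        simp [Matrix.mul_apply, Fin.sum_univ_two]
      rw [h, ha1, hb1, zero_mul, mul_zero, add_zero]
  one_mem' := by
    refine ⟨?_, ?_⟩
    · rw [Matrix.one_apply_eq]; exact evenPart_one_mem K V
    · exact Matrix.one_apply_ne (by decide)
  add_mem' := by
    rintro a b ⟨ha0, ha1⟩ ⟨hb0, hb1⟩
    exact ⟨Submodule.add_mem _ ha0 hb0, by simp [ha1, hb1]⟩
  zero_mem' := ⟨Submodule.zero_mem _, rfl⟩
  algebraMap_mem' := fun c => by
    refine ⟨?_, ?_⟩
    · rw [Matrix.algebraMap_matrix_apply, if_pos rfl]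
      exact evenPart_algebraMap_mem K V c
    · rw [Matrix.algebraMap_matrix_apply, if_neg (by decide)]

/-- The algebra `M_{1,1}` (over the Grassmann algebra of `V`): the subalgebra of `2 × 2`
matrices over `E = Λ(V)` whose diagonal entries lie in `E₀` and whose off-diagonal entries
lie in `E₁`. -/
def m11 : Subalgebra K (Matrix (Fin 2) (Fin 2) (ExteriorAlgebra K V)) where
  carrier := {M | M 0 0 ∈ evenPart K V ∧ M 1 1 ∈ evenPart K V ∧
    M 0 1 ∈ oddPart K V ∧ M 1 0 ∈ oddPart K V}
  mul_mem' := by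
    rintro a b ⟨ha00, ha11, ha01, ha10⟩ ⟨hb00, hb11, hb01, hb10⟩
    have h00 : (a * b) 0 0 = a 0 0 * b 0 0 + a 0 1 * b 1 0 := by
      simp [Matrix.mul_apply, Fin.sum_univ_two]
    have h11 : (a * b) 1 1 = a 1 0 * b 0 1 + a 1 1 * b 1 1 := by
      simp [Matrix.mul_apply, Fin.sum_univ_two]
    have h01 : (a * b) 0 1 = a 0 0 * b 0 1 + a 0 1 * b 1 1 := by
      simp [Matrix.mul_apply, Fin.sum_univ_two]
    have h10 : (a * b) 1 0 = a 1 0 * b 0 0 + a 1 1 * b 1 0 := by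
      simp [Matrix.mul_apply, Fin.sum_univ_two]
    refine ⟨?_, ?_, ?_, ?_⟩
    · rw [h00]
      exact Submodule.add_mem _ (evenPart_mul_mem K V ha00 hb00)
        (oddPart_mul_mem_even K V ha01 hb10)
    · rw [h11]
      exact Submodule.add_mem _ (oddPart_mul_mem_even K V ha10 hb01)
        (evenPart_mul_mem K V ha11 hb11)
    · rw [h01]
      exact Submodule.add_mem _ (even_mul_odd_mem K V ha00 hb01)
        (odd_mul_even_mem K V ha01 hb11)
    · rw [h10]
      exact Submodule.add_mem _ (odd_mul_even_mem K V ha10 hb00)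
        (even_mul_odd_mem K V ha11 hb10)
  one_mem' := by
    refine ⟨?_, ?_, ?_, ?_⟩
    · rw [Matrix.one_apply_eq]; exact evenPart_one_mem K V
    · rw [Matrix.one_apply_eq]; exact evenPart_one_mem K V
    · rw [Matrix.one_apply_ne (by decide)]; exact Submodule.zero_mem _
    · rw [Matrix.one_apply_ne (by decide)]; exact Submodule.zero_mem _
  add_mem' := by
    rintro a b ⟨ha00, ha11, ha01, ha10⟩ ⟨hb00, hb11, hb01, hb10⟩
    exact ⟨Submodule.add_mem _ ha00 hb00, Submodule.add_mem _ ha11 hb11,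
      Submodule.add_mem _ ha01 hb01, Submodule.add_mem _ ha10 hb10⟩
  zero_mem' := ⟨Submodule.zero_mem _, Submodule.zero_mem _,
    Submodule.zero_mem _, Submodule.zero_mem _⟩
  algebraMap_mem' := fun c => by
    refine ⟨?_, ?_, ?_, ?_⟩
    · rw [Matrix.algebraMap_matrix_apply, if_pos rfl]
      exact evenPart_algebraMap_mem K V c
    · rw [Matrix.algebraMap_matrix_apply, if_pos rfl]
      exact evenPart_algebraMap_mem K V c
    · rw [Matrix.algebraMap_matrix_apply, if_neg (by decide)]
      exact Submodule.zero_mem _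
    · rw [Matrix.algebraMap_matrix_apply, if_neg (by decide)]
      exact Submodule.zero_mem _

end matrixAlgebras2

/-- The relatively free algebra `F_n(R) = K⟨x₁, …, xₙ⟩ / (K⟨x₁, …, xₙ⟩ ∩ T(R))` of rank `n`
of the variety generated by `R`: the quotient of the free algebra on `n` variables by the
ideal of polynomial identities of `R` in those variables. -/
abbrev RelFree (K : Type) [Field K] (R : Type) [Ring R] [Algebra K R] (n : ℕ) : Type :=
  RingQuot (fun f g : FreeAlgebra K (Fin n) => IsPI K R (f - g))

end

section EvenCentral

variable {K V : Type} [Field K] [AddCommGroup V] [Module K V]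

theorem ι_mul_ι_commute_ι (u v w : V) :
    Commute (ExteriorAlgebra.ι K u * ExteriorAlgebra.ι K v) (ExteriorAlgebra.ι K w) := by
  have h1 := eq_neg_of_add_eq_zero_left (ExteriorAlgebra.ι_add_mul_swap (R := K) v w)
  have h2 := eq_neg_of_add_eq_zero_left (ExteriorAlgebra.ι_add_mul_swap (R := K) u w)
  rw [commute_iff_eq, mul_assoc, h1, mul_neg, ← mul_assoc, h2, neg_mul, neg_neg, mul_assoc]

theorem evenPart_commute_ι {a : ExteriorAlgebra K V} (ha : a ∈ evenPart K V) (v : V) :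
    Commute a (ExteriorAlgebra.ι K v) := by
  induction a, ha using CliffordAlgebra.even_induction with
  | algebraMap r => exact Algebra.commutes r _
  | add x y hx hy ihx ihy => exact ihx.add_left ihy
  | ι_mul_ι_mul u w x hx ih => exact (ι_mul_ι_commute_ι u w v).mul_left ih

/-- Even elements of the exterior algebra are central. -/
theorem evenPart_commute {a : ExteriorAlgebra K V} (ha : a ∈ evenPart K V)
    (b : ExteriorAlgebra K V) : Commute a b := by
  induction b using ExteriorAlgebra.induction with
  | algebraMap r => exact (Algebra.commutes r a).symm
  | ι v => exact evenPart_commute_ι ha v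
  | mul x y hx hy => exact hx.mul_right hy
  | add x y hx hy => exact hx.add_right hy

theorem ι_mul_odd {b : ExteriorAlgebra K V} (hb : b ∈ oddPart K V) (v : V) :
    ExteriorAlgebra.ι K v * b = -(b * ExteriorAlgebra.ι K v) := by
  induction b, hb using CliffordAlgebra.odd_induction with
  | ι w => exact eq_neg_of_add_eq_zero_left (ExteriorAlgebra.ι_add_mul_swap v w)
  | add x y hx hy ihx ihy => rw [mul_add, ihx, ihy, add_mul, neg_add]
  | ι_mul_ι_mul u w x hx ih =>
    have h := ι_mul_ι_commute_ι (K := K) u w v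
    change ExteriorAlgebra.ι K v * (ExteriorAlgebra.ι K u * ExteriorAlgebra.ι K w * x) =
      -(ExteriorAlgebra.ι K u * ExteriorAlgebra.ι K w * x * ExteriorAlgebra.ι K v)
    rw [← mul_assoc, ← h.eq, mul_assoc, ih, mul_neg, mul_assoc _ x]

/-- Odd elements of the exterior algebra anticommute. -/
theorem odd_mul_odd {a b : ExteriorAlgebra K V} (ha : a ∈ oddPart K V) (hb : b ∈ oddPart K V) :
    a * b = -(b * a) := by
  induction a, ha using CliffordAlgebra.odd_induction with
  | ι v => exact ι_mul_odd hb v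
  | add x y hx hy ihx ihy => rw [add_mul, ihx, ihy, mul_add, neg_add]
  | ι_mul_ι_mul u w x hx ih =>
    have h := evenPart_commute (K := K) (CliffordAlgebra.ι_mul_ι_mem_evenOdd_zero _ u w) b
    rw [mul_assoc, ih, mul_neg, ← mul_assoc, h.eq, mul_assoc]

theorem odd_mul_self [CharZero K] {a : ExteriorAlgebra K V} (ha : a ∈ oddPart K V) :
    a * a = 0 := by
  have h := odd_mul_odd ha ha
  rw [eq_neg_iff_add_eq_zero, ← two_smul K] at h
  exact (smul_eq_zero.mp h).resolve_left two_ne_zero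

theorem exists_even_add_odd (a : ExteriorAlgebra K V) :
    ∃ s ∈ evenPart K V, ∃ t ∈ oddPart K V, s + t = a :=
  Submodule.mem_sup.mp <| by
    have h := (CliffordAlgebra.evenOdd_isCompl (0 : QuadraticForm K V)).sup_eq_top
    exact h ▸ Submodule.mem_top

theorem exteriorPower_eq_bot_of_finrank_lt {M : Type} [AddCommGroup M] [Module K M]
    [Module.Finite K M] {j : ℕ} (hj : Module.finrank K M < j) : ⋀[K]^j M = ⊥ := by
  rw [← ExteriorAlgebra.ιMulti_span_fixedDegree, Submodule.span_eq_bot]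
  rintro _ ⟨v, rfl⟩
  refine AlternatingMap.map_linearDependent _ v fun hv => ?_
  have := hv.fintype_card_le_finrank
  simp only [Fintype.card_fin] at this
  omega

/-- A subspace of odd elements of dimension less than `j` has zero `j`-th power. -/
theorem odd_range_pow_eq_bot [CharZero K] {M : Type} [AddCommGroup M] [Module K M]
    [Module.Finite K M] (T : M →ₗ[K] ExteriorAlgebra K V) (hT : ∀ c, T c ∈ oddPart K V)
    {j : ℕ} (hj : Module.finrank K M < j) : LinearMap.range T ^ j = ⊥ := by
  have h := ExteriorAlgebra.ι_comp_lift (R := K) T fun c => odd_mul_self (hT c)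
  rw [← h, LinearMap.range_comp, ← Submodule.map_pow]
  exact (congrArg _ (exteriorPower_eq_bot_of_finrank_lt hj)).trans (Submodule.map_bot _)

/-- Elements `a + b` with `a` even and `b` in the span of the even multiples of a subspace `W`
of odd elements. -/
def evenAddSpan (W : Submodule K (ExteriorAlgebra K V)) (hW : W ≤ oddPart K V) :
    Subalgebra K (ExteriorAlgebra K V) :=
  Submodule.toSubalgebra (evenPart K V ⊔ evenPart K V * W)
    (Submodule.mem_sup_left (evenPart_one_mem K V)) <| by
    have hEE : evenPart K V * evenPart K V ≤ evenPart K V :=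
      Submodule.mul_le.2 fun a ha b hb => evenPart_mul_mem K V ha hb
    have hO : evenPart K V * W ≤ oddPart K V :=
      Submodule.mul_le.2 fun a ha b hb => even_mul_odd_mem K V ha (hW hb)
    have hEP {a b : ExteriorAlgebra K V} (ha : a ∈ evenPart K V) (hb : b ∈ evenPart K V * W) :
        a * b ∈ evenPart K V * W := by
      have h := Submodule.mul_mem_mul ha hb
      rw [← mul_assoc] at h
      exact mul_le_mul_left hEE _ h
    intro x y hx hy
    obtain ⟨a, ha, b, hb, rfl⟩ := Submodule.mem_sup.mp hx
    obtain ⟨c, hc, d, hd, rfl⟩ := Submodule.mem_sup.mp hy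
    have hbc := hEP hc hb
    rw [(evenPart_commute hc b).eq] at hbc
    have : (a + b) * (c + d) = (a * c + b * d) + (a * d + b * c) := by noncomm_ring
    rw [this]
    exact Submodule.add_mem_sup
      (add_mem (evenPart_mul_mem K V ha hc) (oddPart_mul_mem_even K V (hO hb) (hO hd)))
      (add_mem (hEP ha hd) hbc)

theorem br_mem_of_mem_evenAddSpan {W : Submodule K (ExteriorAlgebra K V)} {hW : W ≤ oddPart K V}
    {x y : ExteriorAlgebra K V} (hx : x ∈ evenAddSpan W hW) (hy : y ∈ evenAddSpan W hW) :
    br x y ∈ (evenPart K V * W) ^ 2 := by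
  obtain ⟨a, ha, b, hb, rfl⟩ := Submodule.mem_sup.mp hx
  obtain ⟨c, hc, d, hd, rfl⟩ := Submodule.mem_sup.mp hy
  have hac := (evenPart_commute ha c).eq
  have had := (evenPart_commute ha d).eq
  have hcb := (evenPart_commute hc b).eq
  have : br (a + b) (c + d) = b * d - d * b := by
    simp only [br, add_mul, mul_add, hac, had, hcb]
    abel
  rw [this, sq]
  exact sub_mem (Submodule.mul_mem_mul hb hd) (Submodule.mul_mem_mul hd hb)

/-- In the subalgebra generated by `m` elements of the exterior algebra, every product of
`k` commutators vanishes as soon as `m < 2 * k`. -/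
theorem prod_br_eq_zero [CharZero K] {m k : ℕ} (hk : m < 2 * k)
    (θ : FreeAlgebra K (Fin m) →ₐ[K] ExteriorAlgebra K V) (f g : ℕ → FreeAlgebra K (Fin m)) :
    ((List.range k).map fun i => br (θ (f i)) (θ (g i))).prod = 0 := by
  choose s hs t ht hst using fun i => exists_even_add_odd (θ (FreeAlgebra.ι K i))
  set T := Fintype.linearCombination K t with hTdef
  have hT (c : Fin m → K) : T c ∈ oddPart K V := by
    rw [hTdef, Fintype.linearCombination_apply]
    exact sum_mem fun i _ => Submodule.smul_mem _ _ (ht i)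
  set W := LinearMap.range T
  have hW : W ≤ oddPart K V := by
    rintro _ ⟨c, rfl⟩
    exact hT c
  have htW (i : Fin m) : t i ∈ W :=
    ⟨Pi.single i 1, by simp [hTdef, Fintype.linearCombination_apply_single]⟩
  have hθ (x : FreeAlgebra K (Fin m)) : θ x ∈ evenAddSpan W hW := by
    induction x using FreeAlgebra.induction with
    | grade0 r => rw [AlgHom.commutes]; exact Subalgebra.algebraMap_mem _ r
    | grade1 i =>
      rw [← hst i]
      refine Submodule.add_mem_sup (hs i) ?_
      simpa using Submodule.mul_mem_mul (evenPart_one_mem K V) (htW i)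
    | mul a b ha hb => rw [map_mul]; exact mul_mem ha hb
    | add a b ha hb => rw [map_add]; exact add_mem ha hb
  have hmem (j : ℕ) : ((List.range j).map fun i => br (θ (f i)) (θ (g i))).prod ∈
      ((evenPart K V * W) ^ 2) ^ j := by
    induction j with
    | zero => simp
    | succ j ih =>
      rw [List.range_succ, List.map_append, List.prod_append, pow_succ]
      exact Submodule.mul_mem_mul ih (by
        simpa using br_mem_of_mem_evenAddSpan (hθ (f j)) (hθ (g j)))
  have hcomm : Commute (evenPart K V) W := by
    refine le_antisymm ?_ ?_ <;> refine Submodule.mul_le.2 fun a ha b hb => ?_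
    · rw [(evenPart_commute ha b).eq]
      exact Submodule.mul_mem_mul hb ha
    · rw [← (evenPart_commute hb a).eq]
      exact Submodule.mul_mem_mul hb ha
  have hzero : ((evenPart K V * W) ^ 2) ^ k = ⊥ := by
    rw [← pow_mul, hcomm.mul_pow, odd_range_pow_eq_bot T hT (by simpa using hk),
      Submodule.mul_bot]
  simpa [hzero] using hmem k

end EvenCentral

section Corner

variable {K V : Type} [Field K] [AddCommGroup V] [Module K V]

/-- The `(2,2)` entry, as an algebra homomorphism on `A`. -/
def algACorner : algA K V →ₐ[K] ExteriorAlgebra K V where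
  toFun M := M.1 1 1
  map_one' := by simp
  map_mul' M N := by
    have := M.2.2
    simp [Matrix.mul_apply, Fin.sum_univ_two, this]
  map_zero' := by simp
  map_add' M N := by simp
  commutes' r := by simp [Matrix.algebraMap_matrix_apply]

theorem algACorner_br (M N : algA K V) :
    algACorner (br M N) = br (algACorner M) (algACorner N) := by
  simp [br]

theorem br_mul_eq_zero (M N P : algA K V) (hP : algACorner P = 0) : br M N * P = 0 := by
  have h00 : (br M N).1 0 0 = 0 := by
    have hM := M.2.2
    have hN := N.2.2
    simp [br, Matrix.mul_apply, Fin.sum_univ_two, hM, hN, (evenPart_commute M.2.1 _).eq]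
  have h10 := (br M N).2.2
  have hP10 := P.2.2
  have hP11 : P.1 1 1 = 0 := hP
  ext i j
  fin_cases i <;> fin_cases j <;>
    simp [Matrix.mul_apply, Fin.sum_univ_two, h00, h10, hP10, hP11]

theorem map_chainProd {R : Type} [Ring R] [Algebra K R] (η : FreeAlgebra K ℕ →ₐ[K] R) (k : ℕ) :
    η (chainProd K k) =
      ((List.range k).map fun i => br (η (xv K (2 * i + 1))) (η (xv K (2 * i + 2)))).prod := by
  simp [chainProd, map_list_prod, br, Function.comp_def]

theorem isPI_relFree_chainProd [CharZero K] {m k : ℕ} (hk : m < 2 * k) :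
    IsPI K (RelFree K (algA K V) m) (chainProd K (k + 1)) := by
  intro φ
  set r := fun f g : FreeAlgebra K (Fin m) => IsPI K (algA K V) (f - g)
  choose w hw using fun i => RingQuot.mkAlgHom_surjective K r (φ (FreeAlgebra.ι K i))
  have hφ : φ = (RingQuot.mkAlgHom K r).comp (FreeAlgebra.lift K w) := by
    ext i
    simp [hw]
  have hPI : IsPI K (algA K V) (FreeAlgebra.lift K w (chainProd K (k + 1)) - 0) := by
    intro ψ
    rw [sub_zero, ← AlgHom.comp_apply, map_chainProd, List.range_succ_eq_map, List.map_cons,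
      List.prod_cons, List.map_map]
    refine br_mul_eq_zero _ _ _ ?_
    rw [map_list_prod, List.map_map]
    simpa only [Function.comp_def, algACorner_br, AlgHom.comp_apply] using
      prod_br_eq_zero hk (algACorner.comp ψ)
        (fun i => FreeAlgebra.lift K w (xv K (2 * (i + 1) + 1)))
        (fun i => FreeAlgebra.lift K w (xv K (2 * (i + 1) + 2)))
  rw [hφ, AlgHom.comp_apply, RingQuot.mkAlgHom_rel K (s := r) hPI, map_zero]

end Corner

/-- For even `n ≥ 2`, the polynomial `[x₁,x₂][x₃,x₄]⋯[x_{n+3},x_{n+4}]`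
is a polynomial identity of both `F_n(A)` and `F_{n+1}(A)`. -/
theorem chain_is_identity_of_relfree (K : Type) [Field K] [CharZero K]
    (n : ℕ) (hn : 2 ≤ n) (hne : Even n) :
    IsPI K (RelFree K (↥(algA K (ℕ →₀ K))) n) (chainProd K ((n + 4) / 2)) ∧
      IsPI K (RelFree K (↥(algA K (ℕ →₀ K))) (n + 1)) (chainProd K ((n + 4) / 2)) := by
  obtain ⟨l, rfl⟩ := hne
  have h : (l + l + 4) / 2 = l + 1 + 1 := by omega
  rw [h]
  exact ⟨isPI_relFree_chainProd (by omega), isPI_relFree_chainProd (by omega)⟩
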